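/- Let a > 0 be a real number and n ≥ 1, and let φ_n be a monic OPUC of degree n for the weight w(θ) := |1 − e^{iθ}|^{2a} on [0, 2π]. If n is even, then φ_n has no real roots. If n is odd, then φ_n has exactly one real root, and this root lies in the open interval (−1, 0). -/

import Mathlib

open Polynomial Complex

/-- `φ` is a monic orthogonal polynomial on the unit circle of degree `n`
for the weight `w` on `[0, 2π]`. -/
def IsMonicOPUC (w : ℝ → ℝ) (n : ℕ) (φ : Polynomial ℂ) : Prop :=
  φ.Monic ∧ φ.degree = (n : ℕ) ∧
    ∀ k < n, (∫ θ in (0:ℝ)..(2 * Real.pi),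
      φ.eval (Complex.exp (θ * Complex.I)) *
        Complex.exp (-(k : ℂ) * θ * Complex.I) * (w θ : ℂ)) = 0

open MeasureTheory intervalIntegral

/-! ### Moments of the weight -/

lemma w_cont (a : ℝ) (ha : 0 < a) : Continuous (fun θ : ℝ => (2 - 2 * Real.cos θ) ^ a) :=
  Continuous.rpow_const (by fun_prop) (fun _ => Or.inr ha.le)

noncomputable def mom (a : ℝ) (l : ℤ) : ℂ :=
  ∫ θ in (0:ℝ)..(2 * Real.pi), Complex.exp (l * θ * I) * (((2 - 2 * Real.cos θ) ^ a : ℝ) : ℂ)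

lemma mom_rec (a : ℝ) (ha : 0 < a) (l : ℤ) :
    (1 + a + l) * mom a (l + 1) = (l - a) * mom a l := by
  have hw := w_cont a ha
  set w : ℝ → ℝ := fun θ : ℝ => (2 - 2 * Real.cos θ) ^ a with hwdef
  have hwc : Continuous (fun θ => (w θ : ℂ)) := continuous_ofReal.comp hw
  have key := integral_eq_sub_of_hasDerivAt_of_le (a := 0) (b := 2 * Real.pi)
    (f := fun θ : ℝ => (Complex.exp (θ * I) - 1) * Complex.exp (l * θ * I) * (w θ : ℂ))
    (f' := fun θ : ℝ => I * ((1 + a + l) * (Complex.exp ((l + 1 : ℤ) * θ * I) * (w θ : ℂ)) -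
      (l - a) * (Complex.exp (l * θ * I) * (w θ : ℂ)))) (by positivity) ?_ ?_ ?_
  · rw [intervalIntegral.integral_const_mul, intervalIntegral.integral_sub,
      intervalIntegral.integral_const_mul, intervalIntegral.integral_const_mul] at key
    · have h2 : Complex.exp (((2 * Real.pi : ℝ) : ℂ) * I) = 1 := by
        push_cast; exact Complex.exp_two_pi_mul_I
      rw [h2] at key
      simp only [sub_self, zero_mul, ofReal_zero, Complex.exp_zero] at key
      have := (mul_eq_zero.1 key).resolve_left I_ne_zero
      exact sub_eq_zero.1 this
    · exact (Continuous.intervalIntegrable (by fun_prop) _ _)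
    · exact (Continuous.intervalIntegrable (by fun_prop) _ _)
  · exact Continuous.continuousOn (by fun_prop)
  · intro θ hθ
    have hcos : 0 < 2 - 2 * Real.cos θ := by
      have : Real.cos θ ≠ 1 := by
        intro h
        rw [Real.cos_eq_one_iff_of_lt_of_lt (by linarith [hθ.1, Real.pi_pos]) hθ.2] at h
        exact hθ.1.ne' h
      have := lt_of_le_of_ne (Real.cos_le_one θ) this
      linarith
    have hwd : HasDerivAt w ((2 * Real.sin θ) * a * (2 - 2 * Real.cos θ) ^ (a - 1)) θ := by
      have h1 : HasDerivAt (fun θ : ℝ => 2 - 2 * Real.cos θ) (2 * Real.sin θ) θ := by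
        exact (((Real.hasDerivAt_cos θ).const_mul 2).const_sub 2).congr_deriv (by ring)
      exact h1.rpow_const (Or.inl hcos.ne')
    have hwd' := hwd.ofReal_comp
    have he : ∀ c : ℂ, HasDerivAt (fun θ : ℝ => Complex.exp (c * θ * I))
        (Complex.exp (c * θ * I) * (c * I)) θ := by
      intro c
      have h0 : HasDerivAt (fun θ : ℝ => c * (θ : ℂ) * I) (c * I) θ := by
        have := ((hasDerivAt_id θ).ofReal_comp.const_mul c).mul_const I
        simpa using this
      exact h0.cexp
    have he1 := he 1
    simp only [one_mul] at he1
    have hF := ((he1.sub_const 1).mul (he l)).mul hwd'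
    refine hF.congr_deriv ?_
    simp only [Pi.mul_apply]
    have hpow : (2 - 2 * Real.cos θ) ^ (a - 1) * (2 - 2 * Real.cos θ) = w θ := by
      rw [hwdef]; simp only
      rw [← Real.rpow_add_one hcos.ne']; simp
    have hpowC : (((2 - 2 * Real.cos θ) ^ (a - 1) : ℝ) : ℂ) * (2 - 2 * Complex.cos θ) = w θ := by
      rw [← hpow]; push_cast; ring
    have hadd : Complex.exp ((l + 1 : ℤ) * θ * I) = Complex.exp (l * θ * I) * Complex.exp (θ * I) := by
      rw [← Complex.exp_add]; congr 1; push_cast; ring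
    rw [hadd]
    push_cast
    rw [← hpowC]
    set r := (((2 - 2 * Real.cos θ) ^ (a - 1) : ℝ) : ℂ)
    set E := Complex.exp (l * θ * I)
    have hz : Complex.exp (θ * I) = Complex.cos θ + Complex.sin θ * I := Complex.exp_mul_I _
    rw [hz]
    have hsc := Complex.sin_sq_add_cos_sq (θ : ℂ)
    have hI : I ^ 2 = -1 := I_sq
    set c := Complex.cos θ
    set s := Complex.sin θ
    linear_combination (2 * a * r * E * I) * hsc + (2 * a * r * E * s * (c - 1)) * hI
  · exact Continuous.intervalIntegrable (by fun_prop) _ _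

lemma rGamma_rec (s : ℝ) : (Real.Gamma s)⁻¹ = s * (Real.Gamma (s + 1))⁻¹ := by
  rcases eq_or_ne s 0 with rfl | h
  · simp [Real.Gamma_zero]
  · rw [Real.Gamma_add_one h]
    field_simp

lemma rGamma_poch (s : ℝ) (m : ℕ) :
    (Real.Gamma s)⁻¹ = (ascPochhammer ℝ m).eval s * (Real.Gamma (s + m))⁻¹ := by
  induction m with
  | zero => simp
  | succ m ih =>
    rw [ih, rGamma_rec (s + m), ascPochhammer_succ_eval]
    push_cast
    rw [add_assoc s, mul_assoc]

noncomputable def GG (a : ℝ) (l : ℤ) : ℝ :=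
  (-1) ^ l * (Real.Gamma (a + 1 + l))⁻¹ * (Real.Gamma (a + 1 - l))⁻¹

lemma GG_rec (a : ℝ) (l : ℤ) : (1 + a + l) * GG a (l + 1) = (l - a) * GG a l := by
  unfold GG
  have h1 := rGamma_rec (a + 1 + l)
  have h2 := rGamma_rec (a - l)
  rw [h1]
  have e1 : a + 1 - ((l + 1 : ℤ) : ℝ) = a - l := by push_cast; ring
  have e2 : a + 1 + ((l + 1 : ℤ) : ℝ) = a + 1 + l + 1 := by push_cast; ring
  have e3 : a + 1 - (l : ℝ) = a - l + 1 := by ring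
  rw [e1, e2, e3, h2, zpow_add_one₀ (by norm_num)]
  ring

lemma mom_eq (a : ℝ) (ha : 0 < a) : ∃ K : ℂ, ∀ l : ℤ, mom a l = K * (GG a l : ℂ) := by
  have h0 : (GG a 0 : ℂ) ≠ 0 := by
    have : 0 < GG a 0 := by
      unfold GG
      have := Real.Gamma_pos_of_pos (show 0 < a + 1 by linarith)
      simp; positivity
    exact_mod_cast this.ne'
  refine ⟨mom a 0 / GG a 0, fun l => ?_⟩
  have hGC : ∀ l : ℤ, (1 + a + l : ℂ) * GG a (l + 1) = (l - a) * GG a l := by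
    intro l; exact_mod_cast GG_rec a l
  induction l with
  | zero => field_simp
  | succ i ih =>
    have hne : (1 + a + (i : ℤ) : ℂ) ≠ 0 := by
      have : (1 + a + (i : ℤ) : ℝ) ≠ 0 := by
        have : (0 : ℝ) ≤ (i : ℤ) := by simp
        linarith
      exact_mod_cast this
    apply mul_left_cancel₀ hne
    rw [mom_rec a ha, ih]
    linear_combination (-mom a 0 / GG a 0) * hGC i
  | pred i ih =>
    have hne : ((-(i : ℤ) - 1 : ℤ) - a : ℂ) ≠ 0 := by
      have : (((-(i : ℤ) - 1 : ℤ) : ℝ) - a : ℝ) ≠ 0 := by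
        have : (0 : ℝ) ≤ i := by simp
        push_cast
        linarith
      exact_mod_cast this
    apply mul_left_cancel₀ hne
    have h1 := mom_rec a ha (-(i : ℤ) - 1)
    have h2 := hGC (-(i : ℤ) - 1)
    rw [sub_add_cancel] at h1 h2
    rw [← h1, ih]
    linear_combination (mom a 0 / GG a 0) * h2

/-! ### The explicit polynomial -/

noncomputable def bb (a : ℝ) (n k : ℕ) : ℝ :=
  n.choose k * (Real.Gamma (a + 1 + k) * Real.Gamma (a + n - k))

lemma alt_sum (n : ℕ) (P : ℝ[X]) (hP : P.natDegree < n) :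
    ∑ k ∈ Finset.range (n + 1), (-1 : ℝ) ^ k * n.choose k * P.eval (k : ℝ) = 0 := by
  have h := congrFun (Polynomial.fwdDiff_iter_eq_zero_of_degree_lt hP) 0
  rw [fwdDiff_iter_eq_sum_shift] at h
  simp only [zero_add, nsmul_eq_mul, mul_one, zsmul_eq_mul, Pi.zero_apply] at h
  push_cast at h
  have h' : (-1 : ℝ) ^ n * ∑ k ∈ Finset.range (n + 1), (-1 : ℝ) ^ k * n.choose k * P.eval (k : ℝ) = 0 := by
    rw [← h, Finset.mul_sum]
    refine Finset.sum_congr rfl fun k hk => ?_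
    have hk' : k ≤ n := by simpa [Nat.lt_succ_iff] using hk
    obtain ⟨d, rfl⟩ := Nat.exists_eq_add_of_le hk'
    rw [Nat.add_sub_cancel_left, pow_add]
    have : ((-1 : ℝ) ^ k) * (-1) ^ k = 1 := by rw [← mul_pow]; simp
    linear_combination ((-1 : ℝ) ^ d * ((k + d).choose k) * P.eval (k : ℝ)) * this
  exact (mul_eq_zero.1 h').resolve_left (by simp)

lemma orth_sum (a : ℝ) (ha : 0 < a) (n m : ℕ) (hm : m < n) :
    ∑ k ∈ Finset.range (n + 1), bb a n k * GG a ((k : ℤ) - m) = 0 := by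
  obtain ⟨d, rfl⟩ := Nat.exists_eq_add_of_lt hm
  set P : ℝ[X] := (ascPochhammer ℝ m).comp (X + C (a + 1 - m)) *
    (ascPochhammer ℝ d).comp (-X + C (a + 1 + m)) with hPdef
  have hP : P.natDegree < m + d + 1 := by
    have h1 : (X + C (a + 1 - m) : ℝ[X]).natDegree ≤ 1 := by compute_degree
    have h2 : (-X + C (a + 1 + m) : ℝ[X]).natDegree ≤ 1 := by compute_degree
    have h3 : ((ascPochhammer ℝ m).comp (X + C (a + 1 - m))).natDegree ≤ m := by
      refine natDegree_comp_le.trans ?_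
      rw [ascPochhammer_natDegree]; nlinarith
    have h4 : ((ascPochhammer ℝ d).comp (-X + C (a + 1 + m))).natDegree ≤ d := by
      refine natDegree_comp_le.trans ?_
      rw [ascPochhammer_natDegree]; nlinarith
    have := natDegree_mul_le (p := (ascPochhammer ℝ m).comp (X + C (a + 1 - m)))
      (q := (ascPochhammer ℝ d).comp (-X + C (a + 1 + m)))
    rw [← hPdef] at this
    omega
  have h := alt_sum _ P hP
  have h' : (-1 : ℝ) ^ (-(m : ℤ)) * ∑ k ∈ Finset.range (m + d + 1 + 1),
    (-1 : ℝ) ^ k * (m + d + 1).choose k * P.eval (k : ℝ) = 0 := by rw [h]; simp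
  rw [← h', Finset.mul_sum]
  refine Finset.sum_congr rfl fun k hk => ?_
  have hk' : k ≤ m + d + 1 := by simpa [Nat.lt_succ_iff] using hk
  have hkR : (k : ℝ) ≤ m + d + 1 := by exact_mod_cast hk'
  unfold bb GG
  have hg1 := rGamma_poch (a + 1 + ((k : ℤ) - m : ℤ)) m
  have hg2 := rGamma_poch (a + 1 - ((k : ℤ) - m : ℤ)) d
  have e1 : a + 1 + (((k : ℤ) - m : ℤ) : ℝ) + m = a + 1 + k := by push_cast; ring
  have e2 : a + 1 - (((k : ℤ) - m : ℤ) : ℝ) + d = a + (m + d + 1 : ℕ) - k := by push_cast; ring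
  have e3 : P.eval (k : ℝ) = (ascPochhammer ℝ m).eval (a + 1 + (((k : ℤ) - m : ℤ) : ℝ)) *
      (ascPochhammer ℝ d).eval (a + 1 - (((k : ℤ) - m : ℤ) : ℝ)) := by
    rw [hPdef]
    simp only [eval_mul, eval_comp, eval_add, eval_X, eval_C, eval_neg]
    push_cast
    congr 2 <;> ring
  rw [hg1, hg2, e1, e2, e3]
  have p1 : Real.Gamma (a + 1 + k) ≠ 0 := (Real.Gamma_pos_of_pos (by positivity)).ne'
  have p2 : Real.Gamma (a + (m + d + 1 : ℕ) - k) ≠ 0 :=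
    (Real.Gamma_pos_of_pos (by push_cast; linarith)).ne'
  have e4 : (-1 : ℝ) ^ ((k : ℤ) - m) = (-1) ^ k * (-1) ^ (-(m : ℤ)) := by
    rw [sub_eq_add_neg, zpow_add₀ (by norm_num), zpow_natCast]
  rw [e4]
  field_simp

noncomputable def PP (a : ℝ) (n : ℕ) : ℂ[X] :=
  ∑ k ∈ Finset.range (n + 1), C ((bb a n k : ℝ) : ℂ) * X ^ k

lemma PP_eval (a : ℝ) (n : ℕ) (z : ℂ) :
    (PP a n).eval z = ∑ k ∈ Finset.range (n + 1), ((bb a n k : ℝ) : ℂ) * z ^ k := by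
  simp [PP, eval_finsetSum]

lemma PP_orth (a : ℝ) (ha : 0 < a) (n m : ℕ) (hm : m < n) :
    (∫ θ in (0:ℝ)..(2 * Real.pi),
      (PP a n).eval (Complex.exp (θ * I)) *
        Complex.exp (-(m : ℂ) * θ * I) * (((2 - 2 * Real.cos θ) ^ a : ℝ) : ℂ)) = 0 := by
  have hw := w_cont a ha
  have hwc : Continuous (fun θ : ℝ => (((2 - 2 * Real.cos θ) ^ a : ℝ) : ℂ)) :=
    continuous_ofReal.comp hw
  obtain ⟨K, hK⟩ := mom_eq a ha
  have e : ∀ θ : ℝ, (PP a n).eval (Complex.exp (θ * I)) *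
        Complex.exp (-(m : ℂ) * θ * I) * (((2 - 2 * Real.cos θ) ^ a : ℝ) : ℂ) =
      ∑ k ∈ Finset.range (n + 1), ((bb a n k : ℝ) : ℂ) *
        (Complex.exp (((k : ℤ) - m : ℤ) * θ * I) * (((2 - 2 * Real.cos θ) ^ a : ℝ) : ℂ)) := by
    intro θ
    rw [PP_eval, Finset.sum_mul, Finset.sum_mul]
    refine Finset.sum_congr rfl fun k _ => ?_
    have : Complex.exp (((k : ℤ) - m : ℤ) * θ * I) =
        Complex.exp (θ * I) ^ k * Complex.exp (-(m : ℂ) * θ * I) := by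
      rw [← Complex.exp_nat_mul, ← Complex.exp_add]; congr 1; push_cast; ring
    rw [this]; ring
  simp_rw [e]
  rw [intervalIntegral.integral_finsetSum]
  · simp_rw [intervalIntegral.integral_const_mul]
    have : ∀ k : ℕ, (∫ θ in (0:ℝ)..(2 * Real.pi), Complex.exp (((k : ℤ) - m : ℤ) * θ * I) *
        (((2 - 2 * Real.cos θ) ^ a : ℝ) : ℂ)) = K * (GG a ((k : ℤ) - m) : ℂ) :=
      fun k => hK _
    simp_rw [this]
    have h := orth_sum a ha n m hm
    have h2 : (∑ k ∈ Finset.range (n + 1), ((bb a n k : ℝ) : ℂ) * (GG a ((k : ℤ) - m) : ℂ)) = 0 := by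
      exact_mod_cast h
    calc _ = K * ∑ k ∈ Finset.range (n + 1), ((bb a n k : ℝ) : ℂ) * (GG a ((k : ℤ) - m) : ℂ) := by
          rw [Finset.mul_sum]; exact Finset.sum_congr rfl fun k _ => by ring
      _ = 0 := by rw [h2, mul_zero]
  · intro k _
    exact Continuous.intervalIntegrable (by fun_prop) _ _

/-! ### Uniqueness -/

lemma uniq (a : ℝ) (ha : 0 < a) (n : ℕ) (p : ℂ[X]) (hp : p.degree < n)
    (h : ∀ k < n, (∫ θ in (0:ℝ)..(2 * Real.pi),
      p.eval (Complex.exp (θ * I)) *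
        Complex.exp (-(k : ℂ) * θ * I) * (((2 - 2 * Real.cos θ) ^ a : ℝ) : ℂ)) = 0) : p = 0 := by
  have hw := w_cont a ha
  have hwc : Continuous (fun θ : ℝ => (((2 - 2 * Real.cos θ) ^ a : ℝ) : ℂ)) :=
    continuous_ofReal.comp hw
  have hpc : Continuous (fun θ : ℝ => p.eval (Complex.exp (θ * I))) :=
    p.continuous.comp (by fun_prop)
  have hconj : ∀ θ : ℝ, (starRingEnd ℂ) (p.eval (Complex.exp (θ * I))) =
      ∑ k ∈ Finset.range n, (starRingEnd ℂ) (p.coeff k) * Complex.exp (-(k : ℂ) * θ * I) := by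
    intro θ
    have hz : (p.eval (Complex.exp (θ * I))) =
        ∑ k ∈ Finset.range n, p.coeff k * Complex.exp (θ * I) ^ k := by
      rcases eq_or_ne p 0 with rfl | hp0
      · simp
      · exact eval_eq_sum_range' ((natDegree_lt_iff_degree_lt hp0).2 hp) _
    rw [hz, map_sum]
    refine Finset.sum_congr rfl fun k _ => ?_
    rw [map_mul, map_pow, ← Complex.exp_conj, ← Complex.exp_nat_mul]
    congr 2
    simp [mul_assoc]
  have hInt0 : (∫ θ in (0:ℝ)..(2 * Real.pi),
      ‖p.eval (Complex.exp (θ * I))‖ ^ 2 * (2 - 2 * Real.cos θ) ^ a) = 0 := by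
    have : (∫ θ in (0:ℝ)..(2 * Real.pi),
      ((‖p.eval (Complex.exp (θ * I))‖ ^ 2 * (2 - 2 * Real.cos θ) ^ a : ℝ) : ℂ)) = 0 := by
      have e : ∀ θ : ℝ, ((‖p.eval (Complex.exp (θ * I))‖ ^ 2 * (2 - 2 * Real.cos θ) ^ a : ℝ) : ℂ) =
          ∑ k ∈ Finset.range n, (starRingEnd ℂ) (p.coeff k) * (p.eval (Complex.exp (θ * I)) *
        Complex.exp (-(k : ℂ) * θ * I) * (((2 - 2 * Real.cos θ) ^ a : ℝ) : ℂ)) := by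
        intro θ
        rw [ofReal_mul, ofReal_pow, ← Complex.mul_conj', hconj, Finset.mul_sum, Finset.sum_mul]
        exact Finset.sum_congr rfl fun k _ => by ring
      simp_rw [e]
      rw [intervalIntegral.integral_finsetSum]
      · refine Finset.sum_eq_zero fun k hk => ?_
        rw [intervalIntegral.integral_const_mul, h k (Finset.mem_range.1 hk), mul_zero]
      · intro k _
        exact Continuous.intervalIntegrable (by fun_prop) _ _
    rw [intervalIntegral.integral_ofReal] at this
    exact_mod_cast this
  have hnn : ∀ θ : ℝ, 0 ≤ ‖p.eval (Complex.exp (θ * I))‖ ^ 2 * (2 - 2 * Real.cos θ) ^ a := by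
    intro θ
    have : 0 ≤ 2 - 2 * Real.cos θ := by linarith [Real.cos_le_one θ]
    positivity
  have hzero : ∀ θ ∈ Set.Ioo (0:ℝ) Real.pi, p.eval (Complex.exp (θ * I)) = 0 := by
    intro θ hθ
    by_contra hne
    have hcos : 0 < 2 - 2 * Real.cos θ := by
      have := Real.cos_lt_cos_of_nonneg_of_le_pi le_rfl hθ.2.le hθ.1
      rw [Real.cos_zero] at this
      linarith
    have := intervalIntegral.integral_pos (a := 0) (b := 2 * Real.pi) (by positivity)
      (f := fun θ => ‖p.eval (Complex.exp (θ * I))‖ ^ 2 * (2 - 2 * Real.cos θ) ^ a)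
      (Continuous.continuousOn (by fun_prop)) (fun x _ => hnn x)
      ⟨θ, ⟨hθ.1.le, by linarith [hθ.2, hθ.1]⟩, by positivity⟩
    exact this.ne' hInt0
  apply Polynomial.eq_zero_of_infinite_isRoot
  have hinf : ((fun θ : ℝ => Complex.exp (θ * I)) '' Set.Ioo (0:ℝ) Real.pi).Infinite := by
    apply Set.Infinite.image _ (Set.Ioo_infinite Real.pi_pos)
    intro x hx y hy hxy
    have := Complex.exp_inj_of_neg_pi_lt_of_le_pi (x := x * I) (y := y * I)
      (by simp; linarith [hx.1, Real.pi_pos]) (by simp; exact hx.2.le)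
      (by simp; linarith [hy.1, Real.pi_pos]) (by simp; exact hy.2.le) hxy
    have := mul_right_cancel₀ I_ne_zero this
    exact_mod_cast this
  refine hinf.mono ?_
  rintro _ ⟨θ, hθ, rfl⟩
  exact hzero θ hθ

/-! ### Integral representation -/

lemma real_beta (u v : ℝ) (hu : 0 < u) (hv : 0 < v) :
    (∫ s in (0:ℝ)..1, s ^ (u - 1) * (1 - s) ^ (v - 1)) =
      Real.Gamma u * Real.Gamma v / Real.Gamma (u + v) := by
  have h := Complex.betaIntegral_eq_Gamma_mul_div (u : ℂ) v (by simpa) (by simpa)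
  unfold Complex.betaIntegral at h
  have e : (∫ x : ℝ in (0:ℝ)..1, (x : ℂ) ^ ((u : ℂ) - 1) * (1 - (x : ℂ)) ^ ((v : ℂ) - 1)) =
      ∫ x : ℝ in (0:ℝ)..1, ((x ^ (u - 1) * (1 - x) ^ (v - 1) : ℝ) : ℂ) := by
    refine intervalIntegral.integral_congr fun x hx => ?_
    rw [Set.uIcc_of_le zero_le_one] at hx
    rw [ofReal_mul, ofReal_cpow hx.1, ofReal_cpow (by linarith [hx.2])]
    push_cast
    rfl
  rw [e, intervalIntegral.integral_ofReal, ← ofReal_add, Complex.Gamma_ofReal, Complex.Gamma_ofReal,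
    Complex.Gamma_ofReal] at h
  exact_mod_cast h

noncomputable def gg (a s : ℝ) : ℝ := s ^ a * (1 - s) ^ (a - 1)

lemma gg_pos (a s : ℝ) (hs : s ∈ Set.Ioo (0:ℝ) 1) : 0 < gg a s := by
  have := hs.1
  have : 0 < 1 - s := by linarith [hs.2]
  unfold gg; positivity

lemma gg_int (a : ℝ) (ha : 0 < a) : IntervalIntegrable (gg a) volume 0 1 := by
  have h1 : IntervalIntegrable (fun s : ℝ => (1 - s) ^ (a - 1)) volume 0 1 := by
    have := (intervalIntegral.intervalIntegrable_rpow' (a := 0) (b := 1)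
      (show -1 < a - 1 by linarith)).comp_sub_left 1
    simpa using this.symm
  refine h1.continuousOn_mul (g := fun s : ℝ => s ^ a) ?_
  exact (Continuous.rpow_const continuous_id (fun _ => Or.inr ha.le)).continuousOn

lemma gg_mul_int (a : ℝ) (ha : 0 < a) (f : ℝ → ℝ) (hf : Continuous f) :
    IntervalIntegrable (fun s => gg a s * f s) volume 0 1 :=
  (gg_int a ha).mul_continuousOn hf.continuousOn

lemma gg_moment (a : ℝ) (ha : 0 < a) (n k : ℕ) (hk : k ≤ n) :
    (∫ s in (0:ℝ)..1, gg a s * (s ^ k * (1 - s) ^ (n - k))) =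
      Real.Gamma (a + 1 + k) * Real.Gamma (a + n - k) / Real.Gamma (2 * a + 1 + n) := by
  have hkR : (k : ℝ) ≤ n := by exact_mod_cast hk
  have hb := real_beta (a + 1 + k) (a + n - k) (by positivity) (by linarith)
  rw [show a + 1 + k + (a + n - k) = 2 * a + 1 + n by ring] at hb
  rw [← hb]
  have hne : ∀ᵐ s : ℝ ∂volume, s ≠ 1 := by
    simp [ae_iff]
  refine intervalIntegral.integral_congr_ae ?_
  filter_upwards [hne] with s hs1 hs
  rw [Set.uIoc_of_le zero_le_one] at hs
  have h0 : 0 < s := hs.1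
  have h1 : 0 < 1 - s := by
    have := lt_of_le_of_ne hs.2 hs1
    linarith
  unfold gg
  rw [show a + 1 + (k : ℝ) - 1 = a + k by ring,
    show a + (n : ℝ) - k - 1 = (a - 1) + ((n - k : ℕ) : ℝ) by rw [Nat.cast_sub hk]; ring,
    Real.rpow_add_natCast h0.ne', Real.rpow_add_natCast h1.ne']
  ring

noncomputable def JJ (a : ℝ) (n : ℕ) (x : ℝ) : ℝ :=
  ∫ s in (0:ℝ)..1, gg a s * (1 - s + s * x) ^ n

lemma JJ_eq (a : ℝ) (ha : 0 < a) (n : ℕ) (x : ℝ) :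
    (∑ k ∈ Finset.range (n + 1), bb a n k * x ^ k) = Real.Gamma (2 * a + 1 + n) * JJ a n x := by
  have e : ∀ s : ℝ, gg a s * (1 - s + s * x) ^ n =
      ∑ k ∈ Finset.range (n + 1), (n.choose k * x ^ k) * (gg a s * (s ^ k * (1 - s) ^ (n - k))) := by
    intro s
    rw [add_comm (1 - s), add_pow, Finset.mul_sum]
    refine Finset.sum_congr rfl fun k _ => ?_
    rw [mul_pow]; ring
  unfold JJ
  simp_rw [e]
  rw [intervalIntegral.integral_finsetSum, Finset.mul_sum]
  · refine Finset.sum_congr rfl fun k hk => ?_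
    have hk' : k ≤ n := by simpa [Nat.lt_succ_iff] using hk
    rw [intervalIntegral.integral_const_mul, gg_moment a ha n k hk']
    have : Real.Gamma (2 * a + 1 + n) ≠ 0 := (Real.Gamma_pos_of_pos (by positivity)).ne'
    unfold bb
    field_simp
  · intro k _
    exact (gg_mul_int a ha _ (by fun_prop)).const_mul _

lemma int_pos_aux (f : ℝ → ℝ) (hf : IntervalIntegrable f volume 0 1) (c : ℝ) (hc0 : 0 < c)
    (hc1 : c ≤ 1) (hnn : ∀ s ∈ Set.Ioo (0:ℝ) 1, 0 ≤ f s) (hp : ∀ s ∈ Set.Ioo (0:ℝ) c, 0 < f s) :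
    0 < ∫ s in (0:ℝ)..1, f s := by
  have i1 : IntervalIntegrable f volume 0 c :=
    hf.mono_set (by rw [Set.uIcc_of_le hc0.le, Set.uIcc_of_le zero_le_one]; exact Set.Icc_subset_Icc le_rfl hc1)
  have i2 : IntervalIntegrable f volume c 1 :=
    hf.mono_set (by rw [Set.uIcc_of_le hc1, Set.uIcc_of_le zero_le_one]; exact Set.Icc_subset_Icc hc0.le le_rfl)
  rw [← intervalIntegral.integral_add_adjacent_intervals i1 i2]
  have h1 := intervalIntegral.intervalIntegral_pos_of_pos_on i1 hp hc0
  have h2 : 0 ≤ ∫ s in c..1, f s := by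
    refine intervalIntegral.integral_nonneg_of_ae_restrict hc1 ?_
    have hne : ∀ᵐ s : ℝ ∂(volume.restrict (Set.Icc c 1)), s ≠ 1 :=
      ae_restrict_of_ae (by simp [ae_iff])
    filter_upwards [hne, ae_restrict_mem measurableSet_Icc] with s hs1 hs
    exact hnn s ⟨by linarith [hs.1], lt_of_le_of_ne hs.2 hs1⟩
  linarith

lemma JJ_even_pos (a : ℝ) (ha : 0 < a) (n : ℕ) (hn : Even n) (x : ℝ) : 0 < JJ a n x := by
  refine int_pos_aux _ (gg_mul_int a ha _ (by fun_prop)) (1 / (1 + |x|)) (by positivity) ?_ ?_ ?_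
  · rw [div_le_one (by positivity)]; linarith [abs_nonneg x]
  · intro s hs
    exact mul_nonneg (gg_pos a s hs).le (hn.pow_nonneg _)
  · intro s hs
    have h1 : s * (1 + |x|) < 1 := (lt_div_iff₀ (by positivity)).1 hs.2
    have h2 := mul_nonneg hs.1.le (abs_nonneg x)
    have h3 : s * (-|x|) ≤ s * x := mul_le_mul_of_nonneg_left (neg_abs_le x) hs.1.le
    exact mul_pos (gg_pos a s ⟨hs.1, by linarith⟩) (pow_pos (by linarith) _)

lemma JJ_odd_mono (a : ℝ) (ha : 0 < a) (n : ℕ) (hn : Odd n) : StrictMono (JJ a n) := by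
  intro x y hxy
  unfold JJ
  rw [← sub_pos, ← intervalIntegral.integral_sub (gg_mul_int a ha _ (by fun_prop))
    (gg_mul_int a ha _ (by fun_prop))]
  refine int_pos_aux _ ((gg_mul_int a ha _ (by fun_prop)).sub (gg_mul_int a ha _ (by fun_prop)))
    1 one_pos le_rfl (fun s hs => le_of_lt ?_) (fun s hs => ?_)
  all_goals
    rw [← mul_sub]
    refine mul_pos (gg_pos a s hs) (sub_pos.2 (hn.strictMono_pow ?_))
    have := mul_lt_mul_of_pos_left hxy hs.1
    linarith

lemma JJ_zero_pos (a : ℝ) (ha : 0 < a) (n : ℕ) : 0 < JJ a n 0 := by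
  refine int_pos_aux _ (gg_mul_int a ha _ (by fun_prop)) 1 one_pos le_rfl
    (fun s hs => le_of_lt ?_) (fun s hs => ?_)
  all_goals exact mul_pos (gg_pos a s hs) (pow_pos (by linarith [hs.2]) _)

lemma JJ_neg_one (a : ℝ) (ha : 0 < a) (n : ℕ) (hn : Odd n) : JJ a n (-1) < 0 := by
  have hi : IntervalIntegrable (fun s => gg a s * (1 - s + s * (-1)) ^ n) volume 0 1 :=
    gg_mul_int a ha _ (by fun_prop)
  have hi2 : IntervalIntegrable (fun s => gg a (1 - s) * (1 - (1 - s) + (1 - s) * (-1)) ^ n)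
      volume 0 1 := by
    have := hi.comp_sub_left 1
    simpa using this.symm
  have h1 : JJ a n (-1) = ∫ s in (0:ℝ)..1, gg a (1 - s) * (1 - (1 - s) + (1 - s) * (-1)) ^ n := by
    unfold JJ
    rw [intervalIntegral.integral_comp_sub_left
      (fun s => gg a s * (1 - s + s * (-1)) ^ n) 1]
    simp
  have h2 : 0 < -(JJ a n (-1) + JJ a n (-1)) := by
    nth_rewrite 2 [h1]
    unfold JJ
    rw [← intervalIntegral.integral_add hi hi2, ← intervalIntegral.integral_neg]
    have key : ∀ s ∈ Set.Ioo (0:ℝ) 1, -(gg a s * (1 - s + s * (-1)) ^ n +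
        gg a (1 - s) * (1 - (1 - s) + (1 - s) * (-1)) ^ n) =
        (s ^ (a - 1) * (1 - s) ^ (a - 1)) * (1 - 2 * s) ^ (n + 1) := by
      intro s hs
      have p1 : 0 < 1 - s := by linarith [hs.2]
      unfold gg
      rw [show 1 - (1 - s) + (1 - s) * (-1) = -(1 - 2 * s) by ring, hn.neg_pow,
        show 1 - s + s * (-1) = 1 - 2 * s by ring, show 1 - (1 - s) = s by ring]
      have q1 : s ^ a = s ^ (a - 1) * s := by rw [← Real.rpow_add_one hs.1.ne']; simp
      have q2 : (1 - s) ^ a = (1 - s) ^ (a - 1) * (1 - s) := by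
        rw [← Real.rpow_add_one p1.ne']; simp
      rw [q1, q2]; ring
    refine int_pos_aux _ ((hi.add hi2).neg) (1 / 2) (by norm_num) (by norm_num) ?_ ?_
    · intro s hs
      have p0 := hs.1
      have p1 : 0 < 1 - s := by linarith [hs.2]
      have := hn.add_one.pow_nonneg (1 - 2 * s)
      have h := key s hs
      rw [h]
      positivity
    · intro s hs
      have p0 := hs.1
      have p1 : 0 < 1 - s := by linarith [hs.2]
      have p2 : 0 < 1 - 2 * s := by linarith [hs.2]
      have h := key s ⟨hs.1, by linarith⟩
      rw [h]
      positivity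
  linarith

lemma JJ_cont (a : ℝ) (ha : 0 < a) (n : ℕ) : Continuous (JJ a n) := by
  have hG : 0 < Real.Gamma (2 * a + 1 + n) := Real.Gamma_pos_of_pos (by positivity)
  have : JJ a n = fun x => (Real.Gamma (2 * a + 1 + n))⁻¹ *
      ∑ k ∈ Finset.range (n + 1), bb a n k * x ^ k := by
    funext x
    rw [JJ_eq a ha]
    field_simp
  rw [this]
  fun_prop

lemma opuc_eq (a : ℝ) (ha : 0 < a) (n : ℕ) (φ : Polynomial ℂ)
    (hφ : IsMonicOPUC (fun θ => (2 - 2 * Real.cos θ) ^ a) n φ) :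
    C ((bb a n n : ℝ) : ℂ) * φ = PP a n := by
  obtain ⟨hmon, hdeg, horth⟩ := hφ
  have hnat : φ.natDegree = n := natDegree_eq_of_degree_eq_some hdeg
  have hw := w_cont a ha
  have hwc : Continuous (fun θ : ℝ => (((2 - 2 * Real.cos θ) ^ a : ℝ) : ℂ)) :=
    continuous_ofReal.comp hw
  have hpc : ∀ p : ℂ[X], Continuous (fun θ : ℝ => p.eval (Complex.exp (θ * I))) :=
    fun p => p.continuous.comp (by fun_prop)
  rw [← sub_eq_zero]
  apply uniq a ha n
  · rw [degree_lt_iff_coeff_zero]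
    intro m hm
    rw [coeff_sub, coeff_C_mul]
    have hPc : (PP a n).coeff m = if m = n then ((bb a n n : ℝ) : ℂ) else 0 := by
      simp only [PP, finsetSum_coeff, coeff_C_mul, coeff_X_pow]
      split_ifs with h
      · subst h
        simp
      · refine Finset.sum_eq_zero fun k hk => ?_
        have : k < n + 1 := Finset.mem_range.1 hk
        rw [if_neg (by omega), mul_zero]
    rw [hPc]
    split_ifs with h
    · subst h
      have : φ.coeff m = 1 := by rw [← hnat] ; exact hmon
      rw [this]; simp
    · rw [coeff_eq_zero_of_natDegree_lt (by omega)]; simp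
  · intro k hk
    have e : ∀ θ : ℝ, (C ((bb a n n : ℝ) : ℂ) * φ - PP a n).eval (Complex.exp (θ * I)) *
        Complex.exp (-(k : ℂ) * θ * I) * (((2 - 2 * Real.cos θ) ^ a : ℝ) : ℂ) =
      ((bb a n n : ℝ) : ℂ) * (φ.eval (Complex.exp (θ * I)) *
        Complex.exp (-(k : ℂ) * θ * I) * (((2 - 2 * Real.cos θ) ^ a : ℝ) : ℂ)) -
      (PP a n).eval (Complex.exp (θ * I)) *
        Complex.exp (-(k : ℂ) * θ * I) * (((2 - 2 * Real.cos θ) ^ a : ℝ) : ℂ) := by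
      intro θ
      simp only [eval_sub, eval_mul, eval_C]
      ring
    simp_rw [e]
    have c1 := hpc φ
    have c2 := hpc (PP a n)
    rw [intervalIntegral.integral_sub (Continuous.intervalIntegrable (by fun_prop) _ _)
      (Continuous.intervalIntegrable (by fun_prop) _ _), intervalIntegral.integral_const_mul,
      horth k hk, PP_orth a ha n k hk]
    simp

lemma root_iff (a : ℝ) (ha : 0 < a) (n : ℕ) (φ : Polynomial ℂ)
    (hφ : IsMonicOPUC (fun θ => (2 - 2 * Real.cos θ) ^ a) n φ) (x : ℝ) :
    φ.IsRoot (x : ℂ) ↔ JJ a n x = 0 := by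
  have h := congrArg (eval (x : ℂ)) (opuc_eq a ha n φ hφ)
  rw [eval_mul, eval_C, PP_eval] at h
  have hb : 0 < bb a n n := by
    unfold bb
    have := Real.Gamma_pos_of_pos (show 0 < a + 1 + (n : ℝ) by positivity)
    have := Real.Gamma_pos_of_pos (show 0 < a + n - (n : ℝ) by simpa)
    simp only [Nat.choose_self]
    positivity
  have hbC : ((bb a n n : ℝ) : ℂ) ≠ 0 := by exact_mod_cast hb.ne'
  have hG : Real.Gamma (2 * a + 1 + n) ≠ 0 := (Real.Gamma_pos_of_pos (by positivity)).ne'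
  have h2 : (∑ k ∈ Finset.range (n + 1), ((bb a n k : ℝ) : ℂ) * (x : ℂ) ^ k) =
      ((Real.Gamma (2 * a + 1 + n) * JJ a n x : ℝ) : ℂ) := by
    rw [← JJ_eq a ha]; push_cast; rfl
  rw [h2] at h
  rw [IsRoot.def]
  constructor
  · intro h0
    rw [h0, mul_zero] at h
    have h3 : Real.Gamma (2 * a + 1 + n) * JJ a n x = 0 := by exact_mod_cast h.symm
    exact (mul_eq_zero.1 h3).resolve_left hG
  · intro h0
    rw [h0, mul_zero, ofReal_zero] at h
    exact (mul_eq_zero.1 h).resolve_left hbC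

theorem opuc_real_roots
    (a : ℝ) (ha : 0 < a) (n : ℕ) (hn : 1 ≤ n)
    (φ : Polynomial ℂ)
    (hφ : IsMonicOPUC (fun θ => (2 - 2 * Real.cos θ) ^ a) n φ) :
    (Even n → ∀ x : ℝ, ¬ φ.IsRoot (x : ℂ)) ∧
      (Odd n → (∃! x : ℝ, φ.IsRoot (x : ℂ)) ∧
        ∀ x : ℝ, φ.IsRoot (x : ℂ) → x ∈ Set.Ioo (-1 : ℝ) 0) := by
  have hr := root_iff a ha n φ hφ
  refine ⟨fun he x hx => ?_, fun ho => ?_⟩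
  · exact (JJ_even_pos a ha n he x).ne' ((hr x).1 hx)
  · have hmono := JJ_odd_mono a ha n ho
    have h0 := JJ_zero_pos a ha n
    have h1 := JJ_neg_one a ha n ho
    refine ⟨?_, fun x hx => ?_⟩
    · obtain ⟨x, -, hx⟩ := intermediate_value_Icc (show (-1 : ℝ) ≤ 0 by norm_num)
        (JJ_cont a ha n).continuousOn (show (0 : ℝ) ∈ Set.Icc _ _ from ⟨h1.le, h0.le⟩)
      refine ⟨x, (hr x).2 hx, fun y hy => ?_⟩
      exact hmono.injective (((hr y).1 hy).trans hx.symm)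
    · have hx0 := (hr x).1 hx
      exact ⟨hmono.lt_iff_lt.1 (by rw [hx0]; exact h1), hmono.lt_iff_lt.1 (by rw [hx0]; exact h0)⟩
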